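/- Let Q(α,β,γ) = β² − 4αγ and ξ ∈ ℝ³ with algebraic, irrational first coordinate α (or more generally α κ-Diophantine for every κ > 1). Then for every t ∈ ℝ, the critical exponent ω₀(Q, ξ, t) is at least 1/8, i.e., for every ω < 1/8 and all sufficiently large T there exists v ∈ ℤ³ with ‖v‖ ≤ T and |Q(v + ξ) − t| ≤ T^{−ω}. -/

import Mathlib

/-- the discriminant quadratic form on row vectors -/
def Qform (v : Fin 3 → ℝ) : ℝ := v 1 ^ 2 - 4 * v 0 * v 2

/-- Euclidean norm on row vectors in ℝ³ -/
noncomputable def enorm3 (v : Fin 3 → ℝ) : ℝ := Real.sqrt (∑ i, v i ^ 2)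

/-- The additive character `x ↦ exp (2πix)` of `ℝ`. -/
noncomputable def unitExp (x : ℝ) : ℂ := Complex.exp (Complex.I * ((2 * Real.pi * x : ℝ) : ℂ))

lemma unitExp_add (x y : ℝ) : unitExp (x + y) = unitExp x * unitExp y := by
  unfold unitExp
  rw [← Complex.exp_add]
  push_cast
  ring_nf

lemma norm_unitExp (x : ℝ) : ‖unitExp x‖ = 1 := by
  unfold unitExp
  rw [mul_comm]
  exact Complex.norm_exp_ofReal_mul_I _

lemma unitExp_zero : unitExp 0 = 1 := by simp [unitExp]

lemma conj_unitExp (x : ℝ) : (starRingEnd ℂ) (unitExp x) = unitExp (-x) := by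
  unfold unitExp
  rw [← Complex.exp_conj, map_mul, Complex.conj_I, Complex.conj_ofReal]
  push_cast
  ring_nf

lemma unitExp_nat_mul (n : ℕ) (x : ℝ) : unitExp (n * x) = unitExp x ^ n := by
  unfold unitExp
  rw [← Complex.exp_nat_mul]
  push_cast
  ring_nf

lemma unitExp_intCast (n : ℤ) : unitExp n = 1 := by
  unfold unitExp
  rw [Complex.exp_eq_one_iff]
  exact ⟨n, by push_cast; ring⟩

lemma unitExp_sub_round (x : ℝ) : unitExp (x - round x) = unitExp x := by
  conv_rhs => rw [← sub_add_cancel x (round x : ℝ), unitExp_add, unitExp_intCast, mul_one]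

lemma four_mul_abs_sub_round_le (x : ℝ) : 4 * |x - round x| ≤ ‖unitExp x - 1‖ := by
  rw [← unitExp_sub_round]
  set r : ℝ := x - round x
  have hr : |r| ≤ 1 / 2 := abs_sub_round x
  have hpi := Real.pi_pos
  unfold unitExp
  rw [Complex.norm_exp_I_mul_ofReal_sub_one, norm_mul, Real.norm_eq_abs, Real.norm_eq_abs,
    show 2 * Real.pi * r / 2 = Real.pi * r by ring]
  have habs : |Real.pi * r| = Real.pi * |r| := by rw [abs_mul, abs_of_pos hpi]
  have h := Real.mul_abs_le_abs_sin (x := Real.pi * r) (by rw [habs]; nlinarith)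
  rw [habs, show 2 / Real.pi * (Real.pi * |r|) = 2 * |r| by field_simp] at h
  norm_num
  linarith

lemma norm_sum_unitExp_le (x : ℝ) (n : ℕ) (hx : 0 < |x - round x|) :
    ‖∑ j ∈ Finset.range n, unitExp (j * x)‖ ≤ 1 / (2 * |x - round x|) := by
  simp_rw [unitExp_nat_mul]
  have h := congrArg norm (mul_geom_sum (unitExp x) n)
  rw [norm_mul] at h
  have h2 : ‖unitExp x ^ n - 1‖ ≤ 2 := by
    refine (norm_sub_le _ _).trans ?_
    rw [norm_pow, norm_unitExp]
    norm_num
  have h4 := four_mul_abs_sub_round_le x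
  rw [le_div_iff₀ (by positivity)]
  have := mul_le_mul_of_nonneg_right h4
    (norm_nonneg (∑ i ∈ Finset.range n, unitExp x ^ i))
  linarith

/-- Van der Corput's inequality with full range of shifts. -/
lemma norm_sum_sq_le (z : ℕ → ℂ) (n : ℕ) :
    ‖∑ b ∈ Finset.range n, z b‖ ^ 2 ≤
      2 * ∑ h ∈ Finset.range n,
        ‖∑ b ∈ Finset.range (n - h), z (b + h) * (starRingEnd ℂ) (z b)‖ := by
  have key : ∀ n : ℕ, ‖∑ b ∈ Finset.range n, z b‖ ^ 2 + ∑ b ∈ Finset.range n, ‖z b‖ ^ 2 =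
      2 * (∑ m ∈ Finset.range n,
        z m * (starRingEnd ℂ) (∑ j ∈ Finset.range (m + 1), z j)).re := by
    intro n
    induction n with
    | zero => simp
    | succ n ih =>
      rw [Finset.sum_range_succ, Finset.sum_range_succ, Finset.sum_range_succ (n := n)
        (f := fun m => z m * (starRingEnd ℂ) (∑ j ∈ Finset.range (m + 1), z j)),
        Complex.add_re, mul_add, ← ih, Finset.sum_range_succ]
      generalize ∑ b ∈ Finset.range n, z b = s
      simp only [Complex.sq_norm, Complex.normSq_apply, map_add, Complex.add_re, Complex.add_im,
        Complex.mul_re, Complex.conj_re, Complex.conj_im]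
      ring
  have flip : ∑ m ∈ Finset.range n, z m * (starRingEnd ℂ) (∑ j ∈ Finset.range (m + 1), z j) =
      ∑ h ∈ Finset.range n, ∑ b ∈ Finset.range (n - h), z (b + h) * (starRingEnd ℂ) (z b) := by
    rw [← Finset.sum_range_diag_flip n (fun h b => z (b + h) * (starRingEnd ℂ) (z b))]
    refine Finset.sum_congr rfl fun m _ => ?_
    rw [← Finset.sum_range_reflect, map_sum, Finset.mul_sum]
    refine Finset.sum_congr rfl fun k hk => ?_
    have hk' : k ≤ m := by simpa [Nat.lt_succ_iff] using hk
    simp only [Nat.add_sub_cancel, Nat.sub_add_cancel hk']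
  have h1 := key n
  rw [flip] at h1
  have h2 : 0 ≤ ∑ b ∈ Finset.range n, ‖z b‖ ^ 2 := Finset.sum_nonneg fun _ _ => by positivity
  have h3 := (Complex.re_le_norm (∑ h ∈ Finset.range n,
    ∑ b ∈ Finset.range (n - h), z (b + h) * (starRingEnd ℂ) (z b))).trans (norm_sum_le _ _)
  linarith

/-- Weyl's inequality for a quadratic polynomial, in terms of the distances from the multiples of
twice the leading coefficient to the integers. -/
lemma norm_sq_sum_unitExp_quadratic_le (a l m : ℝ) (n : ℕ)
    (ha : ∀ h : ℕ, 1 ≤ h → h ≤ n → 0 < |h * (2 * a) - round (h * (2 * a))|) :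
    ‖∑ b ∈ Finset.range n, unitExp (a * b ^ 2 + l * b + m)‖ ^ 2 ≤
      2 * n + ∑ h ∈ Finset.Icc 1 n, 1 / |h * (2 * a) - round (h * (2 * a))| := by
  have hbound : ∀ h : ℕ, 1 ≤ h → h ≤ n →
      ‖∑ b ∈ Finset.range (n - h), unitExp (a * ((b + h : ℕ) : ℝ) ^ 2 + l * ((b + h : ℕ) : ℝ) + m) *
        (starRingEnd ℂ) (unitExp (a * b ^ 2 + l * b + m))‖ ≤
      1 / (2 * |h * (2 * a) - round (h * (2 * a))|) := by
    intro h h1 hn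
    refine le_trans (le_of_eq ?_) (norm_sum_unitExp_le _ (n - h) (ha h h1 hn))
    rw [← one_mul ‖∑ j ∈ Finset.range (n - h), unitExp (j * (h * (2 * a)))‖,
      ← norm_unitExp (a * h ^ 2 + l * h), ← norm_mul, Finset.mul_sum]
    congr 1
    refine Finset.sum_congr rfl fun b _ => ?_
    rw [conj_unitExp, ← unitExp_add, ← unitExp_add]
    congr 1
    push_cast
    ring
  refine (norm_sum_sq_le _ n).trans ?_
  have hsub : Finset.range n ⊆ insert 0 (Finset.Icc 1 n) := by
    intro x hx
    simp only [Finset.mem_insert, Finset.mem_Icc, Finset.mem_range] at *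
    omega
  refine (mul_le_mul_of_nonneg_left (Finset.sum_le_sum_of_subset_of_nonneg hsub
    fun _ _ _ => norm_nonneg _) two_pos.le).trans ?_
  rw [Finset.sum_insert (by simp), mul_add, Finset.mul_sum]
  refine add_le_add ?_ (Finset.sum_le_sum fun h hh => ?_)
  · refine mul_le_mul_of_nonneg_left ((norm_sum_le _ _).trans ?_) two_pos.le
    simp [norm_unitExp]
  · rw [Finset.mem_Icc] at hh
    have := hbound h hh.1 hh.2
    have hp := ha h hh.1 hh.2
    calc _ ≤ 2 * (1 / (2 * |h * (2 * a) - round (h * (2 * a))|)) :=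
          mul_le_mul_of_nonneg_left this two_pos.le
      _ = _ := by field_simp

/-- Points of `[g, 1 / 2]` that are pairwise `g`-separated have a small sum of reciprocals. -/
lemma sum_inv_le_of_separated {ι : Type*} (s : Finset ι) (r : ι → ℝ) (g : ℝ) (hg : 0 < g)
    (hg1 : g ≤ 1) (hlow : ∀ i ∈ s, g ≤ r i) (hup : ∀ i ∈ s, r i ≤ 1)
    (hsep : ∀ i ∈ s, ∀ j ∈ s, i ≠ j → g ≤ |r i - r j|) :
    ∑ i ∈ s, 1 / r i ≤ 1 / g * (1 + Real.log (1 / g)) := by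
  set M := ⌊1 / g⌋₊ with hM
  let F : ι → ℕ := fun i => ⌊r i / g⌋₊
  have hFle : ∀ i ∈ s, (F i : ℝ) ≤ r i / g := fun i hi =>
    Nat.floor_le (div_nonneg (hg.le.trans (hlow i hi)) hg.le)
  have hF1 : ∀ i ∈ s, 1 ≤ F i := fun i hi =>
    Nat.le_floor (by rw [Nat.cast_one, le_div_iff₀ hg]; linarith [hlow i hi])
  have hinj : Set.InjOn F s := by
    intro i hi j hj hij
    by_contra hne
    have h := hsep i hi j hj hne
    have h1 := hFle i hi
    have h2 := hFle j hj
    have h3 : r i / g < F i + 1 := Nat.lt_floor_add_one _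
    have h4 : r j / g < F j + 1 := Nat.lt_floor_add_one _
    rw [hij] at h1 h3
    have : |r i / g - r j / g| < 1 := by rw [abs_lt]; constructor <;> linarith
    rw [← sub_div, abs_div, abs_of_pos hg, div_lt_one hg] at this
    linarith
  have hsubset : s.image F ⊆ Finset.Icc 1 M := by
    intro k hk
    obtain ⟨i, hi, rfl⟩ := Finset.mem_image.1 hk
    rw [Finset.mem_Icc]
    exact ⟨hF1 i hi, Nat.floor_le_floor (div_le_div_of_nonneg_right (hup i hi) hg.le)⟩
  calc ∑ i ∈ s, 1 / r i ≤ ∑ i ∈ s, 1 / g * ((F i : ℝ))⁻¹ := by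
        refine Finset.sum_le_sum fun i hi => ?_
        have h0 : (0 : ℝ) < F i := by exact_mod_cast hF1 i hi
        have h1 := hFle i hi
        rw [le_div_iff₀ hg] at h1
        rw [← div_eq_mul_inv, div_div]
        exact one_div_le_one_div_of_le (by positivity) (by linarith)
    _ = 1 / g * ∑ k ∈ s.image F, ((k : ℝ))⁻¹ := by
        rw [Finset.sum_image hinj, Finset.mul_sum]
    _ ≤ 1 / g * ∑ k ∈ Finset.Icc 1 M, ((k : ℝ))⁻¹ := by
        refine mul_le_mul_of_nonneg_left (Finset.sum_le_sum_of_subset_of_nonneg hsubset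
          fun _ _ _ => by positivity) (by positivity)
    _ ≤ 1 / g * (1 + Real.log (1 / g)) := by
        refine mul_le_mul_of_nonneg_left ?_ (by positivity)
        have h := harmonic_le_one_add_log M
        rw [harmonic_eq_sum_Icc] at h
        push_cast at h
        have hM1 : 1 ≤ M := Nat.le_floor (by rw [Nat.cast_one, le_div_iff₀ hg]; linarith)
        have := Real.log_le_log (x := M) (y := 1 / g) (by exact_mod_cast hM1)
          (Nat.floor_le (by positivity))
        linarith

lemma sum_inv_abs_sub_round_le (φ g : ℝ) (n : ℕ) (hg : 0 < g) (hg1 : g ≤ 1)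
    (h : ∀ k : ℕ, 1 ≤ k → k ≤ n → ∀ p : ℤ, g ≤ |k * φ - p|) :
    ∑ k ∈ Finset.Icc 1 n, 1 / |k * φ - round (k * φ)| ≤ 2 / g * (1 + Real.log (1 / g)) := by
  set r : ℕ → ℝ := fun k => k * φ - round (k * φ) with hr
  have hsep' : ∀ i ∈ Finset.Icc 1 n, ∀ j ∈ Finset.Icc 1 n, i < j → g ≤ |r j - r i| := by
    intro i hi j hj hij
    rw [Finset.mem_Icc] at hi hj
    have := h (j - i) (by omega) (by omega) (round (j * φ) - round (i * φ))
    rw [Nat.cast_sub hij.le] at this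
    refine this.trans (le_of_eq ?_)
    simp only [hr]
    push_cast
    ring_nf
  have hsep : ∀ i ∈ Finset.Icc 1 n, ∀ j ∈ Finset.Icc 1 n, i ≠ j → g ≤ |r i - r j| := by
    intro i hi j hj hij
    rcases lt_or_gt_of_ne hij with h1 | h1
    · rw [abs_sub_comm]; exact hsep' i hi j hj h1
    · exact hsep' j hj i hi h1
  have hlow : ∀ i ∈ Finset.Icc 1 n, g ≤ |r i| := fun i hi =>
    h i (Finset.mem_Icc.1 hi).1 (Finset.mem_Icc.1 hi).2 _
  have hup : ∀ i, |r i| ≤ 1 := fun i => (abs_sub_round _).trans (by norm_num)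
  rw [← Finset.sum_filter_add_sum_filter_not _ (fun k => 0 < r k)]
  have hpos : ∑ k ∈ Finset.Icc 1 n with 0 < r k, 1 / |r k| ≤ 1 / g * (1 + Real.log (1 / g)) := by
    refine sum_inv_le_of_separated _ _ g hg hg1 (fun i hi => hlow i (Finset.mem_filter.1 hi).1)
      (fun i _ => hup i) fun i hi j hj hij => ?_
    rw [Finset.mem_filter] at hi hj
    rw [abs_of_pos hi.2, abs_of_pos hj.2]
    exact hsep i hi.1 j hj.1 hij
  have hneg : ∑ k ∈ Finset.Icc 1 n with ¬ 0 < r k, 1 / |r k| ≤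
      1 / g * (1 + Real.log (1 / g)) := by
    refine sum_inv_le_of_separated _ _ g hg hg1 (fun i hi => hlow i (Finset.mem_filter.1 hi).1)
      (fun i _ => hup i) fun i hi j hj hij => ?_
    rw [Finset.mem_filter, not_lt] at hi hj
    rw [abs_of_nonpos hi.2, abs_of_nonpos hj.2, neg_sub_neg, abs_sub_comm]
    exact hsep i hi.1 j hj.1 hij
  calc _ ≤ 1 / g * (1 + Real.log (1 / g)) + 1 / g * (1 + Real.log (1 / g)) := add_le_add hpos hneg
    _ = _ := by ring

open scoped Pointwise in
/-- A lower bound for the additive energy of an initial segment. -/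
lemma pow_three_le_two_mul_addEnergy_range (K : ℕ) :
    K ^ 3 ≤ 2 * (Finset.range K).addEnergy (Finset.range K) := by
  classical
  rcases Nat.eq_zero_or_pos K with rfl | hK
  · simp
  have h := Finset.le_card_add_mul_addEnergy (Finset.range K) (Finset.range K)
  have hc : (Finset.range K + Finset.range K).card ≤ 2 * K := by
    refine (Finset.card_le_card (t := Finset.range (2 * K)) fun x hx => ?_).trans (by simp)
    obtain ⟨a, ha, b, hb, rfl⟩ := Finset.mem_add.1 hx
    simp only [Finset.mem_range] at *
    omega
  rw [Finset.card_range] at h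
  have h2 := h.trans (Nat.mul_le_mul_right _ hc)
  refine le_of_mul_le_mul_left (a := K) ?_ hK
  nlinarith

lemma norm_sum_unitExp_pow_four (K : ℕ) (x : ℝ) :
    ((‖∑ j ∈ Finset.range K, unitExp (j * x)‖ ^ 4 : ℝ) : ℂ) =
      ∑ p ∈ (Finset.range K ×ˢ Finset.range K) ×ˢ Finset.range K ×ˢ Finset.range K,
        unitExp (((p.1.1 + p.2.1 : ℝ) - (p.1.2 + p.2.2)) * x) := by
  set D := ∑ j ∈ Finset.range K, unitExp (j * x) with hD
  have hsq : ∑ p ∈ Finset.range K ×ˢ Finset.range K, unitExp (((p.1 : ℝ) - p.2) * x) =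
      D * (starRingEnd ℂ) D := by
    rw [hD, map_sum, Finset.sum_mul_sum, ← Finset.sum_product']
    refine Finset.sum_congr rfl fun p _ => ?_
    rw [conj_unitExp, ← unitExp_add]
    ring_nf
  have h4 : ((‖D‖ ^ 4 : ℝ) : ℂ) = (D * (starRingEnd ℂ) D) * (D * (starRingEnd ℂ) D) := by
    rw [Complex.mul_conj, Complex.normSq_eq_norm_sq]
    push_cast
    ring
  rw [h4, ← hsq, Finset.sum_mul_sum, ← Finset.sum_product']
  refine Finset.sum_congr rfl fun p _ => ?_
  rw [← unitExp_add]
  ring_nf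

/-- A finite sequence with small exponential sums comes close to the integers. -/
lemma exists_abs_sub_round_le (n K : ℕ) (x : ℕ → ℝ) (η δ : ℝ) (hK : 0 < K) (hδ : 0 < δ)
    (hη : ∀ k : ℕ, 1 ≤ k → k ≤ 2 * K → ‖∑ b ∈ Finset.range n, unitExp (k * x b)‖ ≤ η)
    (hηn : 4 * K * η < n) (hKδ : 1 ≤ 4 * K ^ 3 * δ ^ 4) :
    ∃ b < n, |x b - round (x b)| ≤ δ := by
  classical
  by_contra! hfar
  set P := (Finset.range K ×ˢ Finset.range K) ×ˢ Finset.range K ×ˢ Finset.range K with hP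
  let c : (ℕ × ℕ) × ℕ × ℕ → ℝ := fun p => (p.1.1 + p.2.1 : ℝ) - (p.1.2 + p.2.2)
  let S : ℝ → ℂ := fun y => ∑ b ∈ Finset.range n, unitExp (y * x b)
  have hη0 : 0 ≤ η := (norm_nonneg _).trans (hη 1 le_rfl (by omega))
  have htotal : ((∑ b ∈ Finset.range n, ‖∑ j ∈ Finset.range K, unitExp (j * x b)‖ ^ 4 : ℝ) : ℂ) =
      ∑ p ∈ P, S (c p) := by
    rw [Complex.ofReal_sum, Finset.sum_comm]
    exact Finset.sum_congr rfl fun b _ => norm_sum_unitExp_pow_four K (x b)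
  have hupper : ∑ b ∈ Finset.range n, ‖∑ j ∈ Finset.range K, unitExp (j * x b)‖ ^ 4 ≤
      n * (1 / (2 * δ)) ^ 4 := by
    refine (Finset.sum_le_card_nsmul _ _ ((1 / (2 * δ)) ^ 4) fun b hb => ?_).trans (by simp)
    have hb' := hfar b (Finset.mem_range.1 hb)
    refine pow_le_pow_left₀ (norm_nonneg _)
      ((norm_sum_unitExp_le _ K (hδ.trans hb')).trans ?_) 4
    exact one_div_le_one_div_of_le (by positivity) (by linarith)
  have hoff : ∀ p ∈ P, ¬ p.1.1 + p.2.1 = p.1.2 + p.2.2 → -η ≤ (S (c p)).re := by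
    intro p hp hne
    refine le_trans ?_ (abs_le.1 (Complex.abs_re_le_norm (S (c p)))).1
    rw [neg_le_neg_iff]
    simp only [hP, Finset.mem_product, Finset.mem_range] at hp
    rcases lt_or_gt_of_ne hne with hlt | hgt
    · have hk := hη (p.1.2 + p.2.2 - (p.1.1 + p.2.1)) (by omega) (by omega)
      rw [← Complex.norm_conj, map_sum] at hk
      refine le_trans (le_of_eq ?_) hk
      congr 1
      refine Finset.sum_congr rfl fun b _ => ?_
      rw [conj_unitExp, Nat.cast_sub hlt.le]
      simp only [c]
      push_cast
      ring_nf
    · have hk := hη (p.1.1 + p.2.1 - (p.1.2 + p.2.2)) (by omega) (by omega)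
      rw [Nat.cast_sub hgt.le] at hk
      simpa only [S, c, Nat.cast_add] using hk
  have hdiag : ∀ p ∈ P, p.1.1 + p.2.1 = p.1.2 + p.2.2 → (S (c p)).re = n := by
    intro p _ heq
    have hc : c p = 0 := by
      have : ((p.1.1 + p.2.1 : ℕ) : ℝ) = ((p.1.2 + p.2.2 : ℕ) : ℝ) := by rw [heq]
      push_cast at this
      simp only [c]
      linarith
    simp [S, hc, unitExp_zero]
  have hlower : (n : ℝ) * (Finset.range K).addEnergy (Finset.range K) - K ^ 4 * η ≤
      (∑ p ∈ P, S (c p)).re := by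
    rw [Complex.re_sum, ← Finset.sum_filter_add_sum_filter_not P
      (fun p => p.1.1 + p.2.1 = p.1.2 + p.2.2)]
    have h1 : ∑ p ∈ P with p.1.1 + p.2.1 = p.1.2 + p.2.2, (S (c p)).re =
        n * (Finset.range K).addEnergy (Finset.range K) := by
      rw [Finset.sum_congr rfl fun p hp => hdiag p (Finset.mem_filter.1 hp).1
        (Finset.mem_filter.1 hp).2, Finset.sum_const, nsmul_eq_mul, mul_comm]
      rfl
    have h2 : -(K ^ 4 * η) ≤
        ∑ p ∈ P with ¬ p.1.1 + p.2.1 = p.1.2 + p.2.2, (S (c p)).re := by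
      have h3 := Finset.card_nsmul_le_sum (P.filter fun p => ¬ p.1.1 + p.2.1 = p.1.2 + p.2.2)
        (fun p => (S (c p)).re) (-η) fun p hp => hoff p (Finset.mem_filter.1 hp).1
          (Finset.mem_filter.1 hp).2
      refine le_trans ?_ h3
      have hcard : ((P.filter fun p => ¬ p.1.1 + p.2.1 = p.1.2 + p.2.2).card : ℝ) ≤ K ^ 4 := by
        have := Finset.card_filter_le P fun p => ¬ p.1.1 + p.2.1 = p.1.2 + p.2.2
        have hPc : P.card = K ^ 4 := by
          simp only [hP, Finset.card_product, Finset.card_range]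
          ring
        rw [hPc] at this
        exact_mod_cast this
      rw [nsmul_eq_mul]
      nlinarith
    linarith
  rw [← htotal, Complex.ofReal_re] at hlower
  have hE : (K : ℝ) ^ 3 ≤ 2 * (Finset.range K).addEnergy (Finset.range K) := by
    exact_mod_cast pow_three_le_two_mul_addEnergy_range K
  have hK' : (0 : ℝ) < K := by exact_mod_cast hK
  have hn : (0 : ℝ) < n := lt_of_le_of_lt (by positivity) hηn
  have h1 := hlower.trans hupper
  have h2 : (1 / (2 * δ)) ^ 4 ≤ K ^ 3 / 4 := by
    rw [div_pow, one_pow, div_le_iff₀ (by positivity)]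
    nlinarith
  have h3 : (n : ℝ) * (1 / (2 * δ)) ^ 4 ≤ n * (K ^ 3 / 4) := mul_le_mul_of_nonneg_left h2 hn.le
  have h4 := mul_le_mul_of_nonneg_left hE hn.le
  have h5 := mul_lt_mul_of_pos_left hηn (pow_pos hK' 3)
  nlinarith

lemma eventually_const_mul_rpow_le (C : ℝ) {a b : ℝ} (hab : a < b) :
    ∀ᶠ x : ℝ in Filter.atTop, C * x ^ a ≤ x ^ b := by
  filter_upwards [(tendsto_rpow_atTop (sub_pos.2 hab)).eventually_ge_atTop C,
    Filter.eventually_gt_atTop 0] with x hx hx0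
  calc C * x ^ a ≤ x ^ (b - a) * x ^ a :=
        mul_le_mul_of_nonneg_right hx (Real.rpow_nonneg hx0.le _)
    _ = x ^ b := by rw [← Real.rpow_add hx0, sub_add_cancel]

/-- If `α` is `κ`-Diophantine, then so is `1 / (4 * α)`. -/
lemma diophantine_one_div_four_mul (α κ : ℝ) (hα : α ≠ 0) (hκ : 0 < κ)
    (hdio : ∃ c₀ > 0, ∀ q : ℕ, 0 < q → ∀ p : ℤ,
      c₀ / (q : ℝ) ^ κ ≤ |(q : ℝ) * α - (p : ℝ)|) :
    ∃ c > 0, ∀ q : ℕ, 0 < q → ∀ p : ℤ,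
      c / (q : ℝ) ^ κ ≤ |(q : ℝ) * (1 / (4 * α)) - (p : ℝ)| := by
  obtain ⟨c₀, hc₀, h⟩ := hdio
  set θ := 1 / (4 * α) with hθ
  have hθ0 : 0 < |θ| := abs_pos.2 (by positivity)
  have hα0 : 0 < |α| := abs_pos.2 hα
  set C := 4 * (|θ| + 1) with hC
  have hC0 : 0 < C := by positivity
  set c₁ := c₀ / (C ^ κ * (4 * |α|)) with hc₁
  have hc₁0 : 0 < c₁ := by positivity
  refine ⟨min 1 (min |θ| c₁), by positivity, fun q hq p => ?_⟩
  have hq1 : (1 : ℝ) ≤ q := by exact_mod_cast hq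
  have hq0 : (0 : ℝ) < q := by linarith
  have hqκ : 1 ≤ (q : ℝ) ^ κ := Real.one_le_rpow hq1 hκ.le
  have hle : min 1 (min |θ| c₁) / (q : ℝ) ^ κ ≤ min 1 (min |θ| c₁) :=
    div_le_self (by positivity) hqκ
  rcases eq_or_ne p 0 with rfl | hp
  · refine hle.trans (((min_le_right _ _).trans (min_le_left _ _)).trans ?_)
    rw [Int.cast_zero, sub_zero, abs_mul, abs_of_pos hq0]
    nlinarith
  rcases lt_or_ge 1 |(q : ℝ) * θ - p| with hbig | hsmall
  · exact hle.trans ((min_le_left _ _).trans hbig.le)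
  have hpabs : (4 * p.natAbs : ℝ) ≤ C * q := by
    have h1 : |(p : ℝ)| ≤ |(q : ℝ) * θ - p| + |(q : ℝ) * θ| := by
      rw [abs_sub_comm]
      have := abs_add_le ((p : ℝ) - q * θ) (q * θ)
      simpa using this
    rw [abs_mul, abs_of_pos hq0] at h1
    rw [Nat.cast_natAbs, Int.cast_abs]
    nlinarith
  have hn : 0 < 4 * p.natAbs := by
    have := Int.natAbs_pos.2 hp
    omega
  have hkey : c₀ / ((4 * p.natAbs : ℕ) : ℝ) ^ κ ≤ |4 * p * α - q| := by
    rcases lt_or_gt_of_ne hp with hneg | hpos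
    · refine (h _ hn (-q)).trans (le_of_eq ?_)
      rw [← abs_neg, Nat.cast_mul, Nat.cast_natAbs, Int.cast_abs,
        abs_of_neg (show (p : ℝ) < 0 by exact_mod_cast hneg)]
      push_cast
      ring_nf
    · refine (h _ hn q).trans (le_of_eq ?_)
      rw [Nat.cast_mul, Nat.cast_natAbs, Int.cast_abs, abs_of_pos (show (0 : ℝ) < p by exact_mod_cast hpos)]
      push_cast
      ring_nf
  have heq : |(q : ℝ) * θ - p| = |4 * p * α - q| / (4 * |α|) := by
    rw [show (q : ℝ) * θ - p = -((4 * p * α - q) / (4 * α)) by rw [hθ]; field_simp; ring,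
      abs_neg, abs_div, abs_mul, abs_of_pos (four_pos : (0 : ℝ) < 4)]
  rw [heq, le_div_iff₀ (by positivity)]
  refine le_trans ?_ hkey
  have hn' : (0 : ℝ) < ((4 * p.natAbs : ℕ) : ℝ) := by exact_mod_cast hn
  calc min 1 (min |θ| c₁) / (q : ℝ) ^ κ * (4 * |α|) ≤ c₁ / (q : ℝ) ^ κ * (4 * |α|) := by
        gcongr
        exact (min_le_right _ _).trans (min_le_right _ _)
    _ = c₀ / (C * q) ^ κ := by
        rw [Real.mul_rpow hC0.le hq0.le, hc₁]
        field_simp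
    _ ≤ c₀ / ((4 * p.natAbs : ℕ) : ℝ) ^ κ := by
        refine div_le_div_of_nonneg_left hc₀.le (by positivity)
          (Real.rpow_le_rpow hn'.le ?_ hκ.le)
        push_cast
        exact hpabs

lemma one_add_log_le (ε y : ℝ) (hε : 0 < ε) (hy : 1 ≤ y) :
    1 + Real.log y ≤ (1 + 1 / ε) * y ^ ε := by
  have h1 := Real.log_le_rpow_div (x := y) (by linarith) hε
  have h2 : 1 ≤ y ^ ε := Real.one_le_rpow hy hε.le
  rw [div_eq_mul_one_div] at h1
  linarith

/-- Weyl sums of a quadratic polynomial whose leading coefficient is `κ`-Diophantine. -/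
lemma norm_sq_weylSum_le (θ l m κ c : ℝ) (hκ : 1 < κ) (hc : 0 < c) (hc1 : c ≤ 1)
    (hθ : ∀ q : ℕ, 0 < q → ∀ p : ℤ, c / (q : ℝ) ^ κ ≤ |(q : ℝ) * θ - (p : ℝ)|)
    (n K k : ℕ) (hn : 0 < n) (hK : 0 < K) (hk : 1 ≤ k) (hkK : k ≤ 2 * K) :
    ‖∑ b ∈ Finset.range n, unitExp (k * (θ * b ^ 2 + l * b + m))‖ ^ 2 ≤
      2 * n + 2 * (1 + 1 / (κ - 1)) * ((4 * K * n) ^ κ / c) ^ κ := by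
  have hn' : (1 : ℝ) ≤ n := by exact_mod_cast hn
  have hK' : (1 : ℝ) ≤ K := by exact_mod_cast hK
  have hY : (1 : ℝ) ≤ 4 * K * n := by nlinarith
  have hYκ : 1 ≤ (4 * K * n : ℝ) ^ κ := Real.one_le_rpow hY (by linarith)
  set y : ℝ := (4 * K * n) ^ κ / c with hy
  have hy1 : 1 ≤ y := by rw [hy, le_div_iff₀ hc]; linarith
  have hy0 : 0 < y := by linarith
  have hdist : ∀ h : ℕ, 1 ≤ h → h ≤ n → ∀ p : ℤ, 1 / y ≤ |h * (2 * (k * θ)) - p| := by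
    intro h h1 hhn p
    have hpos : 0 < 2 * k * h := by positivity
    have hq := hθ (2 * k * h) hpos p
    have hcast : ((2 * k * h : ℕ) : ℝ) ≤ 4 * K * n := by
      have : 2 * k * h ≤ 4 * K * n := Nat.mul_le_mul (by omega) hhn
      exact_mod_cast this
    have hpos' : (0 : ℝ) < ((2 * k * h : ℕ) : ℝ) := by exact_mod_cast hpos
    calc 1 / y = c / (4 * K * n : ℝ) ^ κ := by rw [hy, one_div_div]
      _ ≤ c / ((2 * k * h : ℕ) : ℝ) ^ κ :=
          div_le_div_of_nonneg_left hc.le (by positivity)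
            (Real.rpow_le_rpow hpos'.le hcast (by linarith))
      _ ≤ _ := hq
      _ = _ := by push_cast; ring_nf
  have hy' : 0 < 1 / y := by positivity
  have hweyl := norm_sq_sum_unitExp_quadratic_le (k * θ) (k * l) (k * m) n
    fun h h1 hhn => hy'.trans_le (hdist h h1 hhn _)
  have hsum := sum_inv_abs_sub_round_le (2 * (k * θ)) (1 / y) n hy'
    (by rw [div_le_one hy0]; exact hy1) hdist
  rw [one_div_one_div, div_div_eq_mul_div, div_one] at hsum
  have hlog := one_add_log_le (κ - 1) y (by linarith) hy1
  have hpow : y * y ^ (κ - 1) = y ^ κ := by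
    rw [← Real.rpow_one_add' hy0.le (by linarith), add_sub_cancel]
  have hfun : ∀ b : ℕ, (k : ℝ) * (θ * b ^ 2 + l * b + m) = k * θ * b ^ 2 + k * l * b + k * m :=
    fun b => by ring
  simp_rw [hfun]
  refine hweyl.trans (add_le_add le_rfl (hsum.trans ?_))
  calc 2 * y * (1 + Real.log y) ≤ 2 * y * ((1 + 1 / (κ - 1)) * y ^ (κ - 1)) :=
        mul_le_mul_of_nonneg_left hlog (by positivity)
    _ = 2 * (1 + 1 / (κ - 1)) * (y * y ^ (κ - 1)) := by ring
    _ = _ := by rw [hpow]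

/-- A quadratic polynomial whose leading coefficient is `κ`-Diophantine for every `κ > 1` takes
values close to the integers at small arguments. -/
lemma eventually_exists_quadratic_near_int (θ l m ρ : ℝ)
    (hθ : ∀ κ : ℝ, 1 < κ → ∃ c > 0, ∀ q : ℕ, 0 < q → ∀ p : ℤ,
      c / (q : ℝ) ^ κ ≤ |(q : ℝ) * θ - (p : ℝ)|)
    (hρ0 : 0 < ρ) (hρ : ρ < 1 / 4) :
    ∀ᶠ n : ℕ in Filter.atTop, ∃ b : ℕ, b < n ∧
      |(θ * b ^ 2 + l * b + m) - round (θ * b ^ 2 + l * b + m)| ≤ (n : ℝ) ^ (-ρ) := by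
  set σ := 4 * ρ / 3 with hσ
  set κ := 4 / 3 - σ with hκ
  have hκ1 : 1 < κ := by linarith
  have hσ0 : 0 < σ := by positivity
  have hexp : 2 * σ + (1 + σ) * κ * κ < 2 := by
    have h1 : 0 < 1 / 3 - σ := by linarith
    have h2 := mul_pos h1 h1
    have h3 := mul_pos h2 h1
    rw [hκ]
    nlinarith
  obtain ⟨c', hc'0, hc'⟩ := hθ κ hκ1
  set c := min 1 c'
  have hc0 : 0 < c := by positivity
  have hc : ∀ q : ℕ, 0 < q → ∀ p : ℤ, c / (q : ℝ) ^ κ ≤ |(q : ℝ) * θ - (p : ℝ)| :=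
    fun q hq p => le_trans (by gcongr; exact min_le_right _ _) (hc' q hq p)
  set C₁ := 2 * (1 + 1 / (κ - 1)) with hC₁
  have hC₁0 : 0 < C₁ := by
    have : 0 < κ - 1 := by linarith
    positivity
  set C₂ := C₁ * (8 ^ κ / c) ^ κ with hC₂
  have ev1 := tendsto_natCast_atTop_atTop.eventually
    (eventually_const_mul_rpow_le 512 (show 2 * σ + 1 < 2 by linarith))
  have ev2 := tendsto_natCast_atTop_atTop.eventually
    (eventually_const_mul_rpow_le (256 * C₂) hexp)
  filter_upwards [ev1, ev2, Filter.eventually_gt_atTop 0] with n h1 h2 hn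
  have hX1 : (1 : ℝ) ≤ n := by exact_mod_cast hn
  set X : ℝ := (n : ℝ)
  have hX0 : 0 < X := by linarith
  set K := ⌈X ^ σ⌉₊
  have hXσ : 1 ≤ X ^ σ := Real.one_le_rpow hX1 hσ0.le
  have hKlow : X ^ σ ≤ K := Nat.le_ceil _
  have hKup : (K : ℝ) ≤ 2 * X ^ σ := by
    have := Nat.ceil_lt_add_one (show 0 ≤ X ^ σ by linarith)
    linarith
  have hK : 0 < K := Nat.ceil_pos.2 (by linarith)
  have hK' : (1 : ℝ) ≤ K := by exact_mod_cast hK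
  set E : ℝ := 2 * X + C₁ * ((4 * K * X) ^ κ / c) ^ κ with hE
  have hE0 : 0 ≤ E := by positivity
  have hEle : E ≤ 2 * X + C₂ * X ^ ((1 + σ) * κ * κ) := by
    have h3 : 4 * K * X ≤ 8 * X ^ (1 + σ) := by
      rw [Real.rpow_add hX0, Real.rpow_one]
      nlinarith
    have h4 : ((4 * K * X) ^ κ / c) ^ κ ≤ ((8 * X ^ (1 + σ)) ^ κ / c) ^ κ := by
      gcongr
    have h5 : ((8 * X ^ (1 + σ)) ^ κ / c) ^ κ = (8 ^ κ / c) ^ κ * X ^ ((1 + σ) * κ * κ) := by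
      rw [Real.mul_rpow (by norm_num) (by positivity), mul_div_right_comm,
        Real.mul_rpow (by positivity) (by positivity), ← Real.rpow_mul hX0.le,
        ← Real.rpow_mul hX0.le]
    rw [hE, hC₂, mul_assoc C₁, ← h5]
    gcongr
  have hKE : (4 * K * Real.sqrt E) ^ 2 < X ^ 2 := by
    have h6 : (K : ℝ) ^ 2 ≤ 4 * X ^ (2 * σ) := by
      calc (K : ℝ) ^ 2 ≤ (2 * X ^ σ) ^ 2 := by gcongr
        _ = 4 * X ^ (2 * σ) := by
          rw [mul_pow, two_mul σ, Real.rpow_add hX0]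
          ring
    rw [Real.rpow_add hX0, Real.rpow_one, Real.rpow_two] at h1
    rw [Real.rpow_add hX0, Real.rpow_two] at h2
    calc (4 * K * Real.sqrt E) ^ 2 = 16 * K ^ 2 * E := by
          rw [mul_pow, Real.sq_sqrt hE0]
          ring
      _ ≤ 16 * (4 * X ^ (2 * σ)) * (2 * X + C₂ * X ^ ((1 + σ) * κ * κ)) := by gcongr
      _ ≤ X ^ 2 / 4 + X ^ 2 / 4 := by linarith
      _ < X ^ 2 := by nlinarith
  refine exists_abs_sub_round_le n K (fun b => θ * b ^ 2 + l * b + m) (Real.sqrt E) (X ^ (-ρ)) hK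
    (by positivity) (fun k hk hkK => ?_) (lt_of_pow_lt_pow_left₀ 2 hX0.le hKE) ?_
  · exact Real.le_sqrt_of_sq_le
      (norm_sq_weylSum_le θ l m κ c hκ1 hc0 (min_le_left _ _) hc n K k hn hK hk hkK)
  · have h7 : X ^ (3 * σ) ≤ (K : ℝ) ^ 3 := by
      calc X ^ (3 * σ) = (X ^ σ) ^ 3 := by
            rw [mul_comm, Real.rpow_mul hX0.le]
            norm_cast
        _ ≤ _ := by gcongr
    have h8 : (X ^ (-ρ)) ^ 4 = X ^ (-(3 * σ)) := by
      rw [← Real.rpow_natCast, ← Real.rpow_mul hX0.le]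
      congr 1
      rw [hσ]
      push_cast
      ring
    have h9 : X ^ (3 * σ) * X ^ (-(3 * σ)) = 1 := by
      rw [← Real.rpow_add hX0, add_neg_cancel, Real.rpow_zero]
    rw [h8]
    have := mul_le_mul_of_nonneg_right h7 (show 0 ≤ X ^ (-(3 * σ)) by positivity)
    linarith

lemma enorm3_le_abs_add_abs (b c : ℤ) :
    enorm3 (fun i => ((![0, b, c] : Fin 3 → ℤ) i : ℝ)) ≤ |(b : ℝ)| + |(c : ℝ)| := by
  unfold enorm3
  rw [Real.sqrt_le_iff]
  refine ⟨by positivity, ?_⟩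
  simp only [Fin.sum_univ_three, Matrix.cons_val_zero, Matrix.cons_val_one, Matrix.cons_val]
  have h1 := sq_abs (b : ℝ)
  have h2 := sq_abs (c : ℝ)
  have h3 := mul_nonneg (abs_nonneg (b : ℝ)) (abs_nonneg (c : ℝ))
  push_cast
  nlinarith

theorem critical_exponent_bound (α β γ : ℝ)
    (hdio : ∀ κ : ℝ, 1 < κ → ∃ c₀ > 0, ∀ q : ℕ, 0 < q → ∀ p : ℤ,
      c₀ / (q : ℝ) ^ κ ≤ |(q : ℝ) * α - (p : ℝ)|)
    (t : ℝ) (ω : ℝ) (hω0 : 0 < ω) (hω : ω < 1 / 8) :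
    ∃ T₀ : ℝ, ∀ T : ℝ, T₀ ≤ T →
      ∃ v : Fin 3 → ℤ, enorm3 (fun i => (v i : ℝ)) ≤ T ∧
        |Qform ((fun i => (v i : ℝ)) + ![α, β, γ]) - t| ≤ T ^ (-ω) := by
  have hα : α ≠ 0 := by
    rintro rfl
    obtain ⟨c₀, hc₀, h⟩ := hdio 2 (by norm_num)
    have := h 1 one_pos 0
    norm_num at this
    linarith
  set θ := 1 / (4 * α) with hθ
  set l := 2 * β * θ with hl
  set m := (β ^ 2 - t) * θ - γ with hm
  set ρ := ω + 1 / 8 with hρ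
  have hρ0 : 0 < ρ := by positivity
  set τ := (1 / 2 + ω / ρ) / 2 with hτ
  have hωρ : ω / ρ < 1 / 2 := by
    rw [div_lt_iff₀ hρ0]
    linarith
  have hτ0 : 0 < τ := by positivity
  have hτρ : ω < τ * ρ := by
    rw [← div_lt_iff₀ hρ0]
    linarith
  have hnear := eventually_exists_quadratic_near_int θ l m ρ
    (fun κ hκ => diophantine_one_div_four_mul α κ hα (by linarith) (hdio κ hκ)) hρ0 (by linarith)
  have hfloor : Filter.Tendsto (fun T : ℝ => ⌊T ^ τ⌋₊) Filter.atTop Filter.atTop :=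
    tendsto_nat_floor_atTop.comp (tendsto_rpow_atTop hτ0)
  set C := |θ| + |l| + |m| + 2
  have hC0 : 0 < C := by positivity
  rw [← Filter.eventually_atTop]
  filter_upwards [hfloor.eventually hnear, hfloor.eventually_ge_atTop 1,
    eventually_const_mul_rpow_le (4 * |α| * 2 ^ ρ) (neg_lt_neg hτρ),
    eventually_const_mul_rpow_le C (show τ * 2 < 1 by linarith),
    Filter.eventually_ge_atTop 1] with T hT hn hαT hCT hT1
  obtain ⟨b, hb, hbn⟩ := hT
  set n := ⌊T ^ τ⌋₊ with hndef
  set f := θ * (b : ℝ) ^ 2 + l * b + m with hf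
  have hT0 : 0 < T := by linarith
  have hn1 : (1 : ℝ) ≤ n := by exact_mod_cast hn
  have hnT : (n : ℝ) ≤ T ^ τ := Nat.floor_le (by positivity)
  have hTn : T ^ τ / 2 ≤ n := by
    have := Nat.lt_floor_add_one (T ^ τ)
    rw [← hndef] at this
    linarith
  have hbn' : (b : ℝ) ≤ n := by exact_mod_cast hb.le
  have hb0 : (0 : ℝ) ≤ b := b.cast_nonneg
  refine ⟨![0, (b : ℤ), round f], ?_, ?_⟩
  · have hfle : |f| ≤ (|θ| + |l| + |m|) * n ^ 2 := by
      have h1 : |f| ≤ |θ| * b ^ 2 + |l| * b + |m| := by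
        refine (abs_add_le _ _).trans (add_le_add ((abs_add_le _ _).trans ?_) le_rfl)
        rw [abs_mul, abs_mul, abs_of_nonneg hb0, abs_of_nonneg (sq_nonneg (b : ℝ))]
      have h2 : (b : ℝ) ^ 2 ≤ n ^ 2 := by gcongr
      have h3 : (b : ℝ) ≤ n ^ 2 := by nlinarith
      have h4 : (1 : ℝ) ≤ n ^ 2 := by nlinarith
      have h5 := mul_le_mul_of_nonneg_left h2 (abs_nonneg θ)
      have h6 := mul_le_mul_of_nonneg_left h3 (abs_nonneg l)
      have h7 := mul_le_mul_of_nonneg_left h4 (abs_nonneg m)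
      linarith
    have hround : |(round f : ℝ)| ≤ |f| + 1 := by
      have h1 := abs_sub_round f
      have h2 := abs_sub_abs_le_abs_sub (round f : ℝ) f
      rw [abs_sub_comm] at h2
      linarith
    refine (enorm3_le_abs_add_abs _ _).trans ?_
    rw [Int.cast_natCast, abs_of_nonneg hb0]
    calc (b : ℝ) + |(round f : ℝ)| ≤ C * n ^ 2 := by nlinarith
      _ ≤ C * (T ^ τ) ^ 2 := by gcongr
      _ = C * T ^ (τ * 2) := by rw [Real.rpow_mul hT0.le, Real.rpow_two]
      _ ≤ T := by simpa using hCT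
  · have hQ : Qform ((fun i => ((![0, (b : ℤ), round f] : Fin 3 → ℤ) i : ℝ)) + ![α, β, γ]) - t =
        4 * α * (f - round f) := by
      simp only [Qform, Pi.add_apply, Matrix.cons_val_zero, Matrix.cons_val_one, Matrix.cons_val]
      rw [hf, hm, hl, hθ]
      push_cast
      field_simp
      ring
    rw [hQ, abs_mul, abs_mul, abs_of_pos (four_pos : (0 : ℝ) < 4)]
    calc 4 * |α| * |f - round f| ≤ 4 * |α| * (n : ℝ) ^ (-ρ) := by gcongr
      _ ≤ 4 * |α| * (T ^ τ / 2) ^ (-ρ) := by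
          refine mul_le_mul_of_nonneg_left ?_ (by positivity)
          exact Real.rpow_le_rpow_of_nonpos (by positivity) hTn (by linarith)
      _ = 4 * |α| * 2 ^ ρ * T ^ (-(τ * ρ)) := by
          rw [Real.div_rpow (by positivity) (by norm_num), ← Real.rpow_mul hT0.le,
            Real.rpow_neg (by norm_num : (0 : ℝ) ≤ 2), div_inv_eq_mul, mul_neg]
          ring
      _ ≤ T ^ (-ω) := hαT
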